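/- Uniform exponential moment bound for block averages: fix g : ℕ → ℝ with g(0) = 0, g(k) > 0 for k ≥ 1, satisfying the gap condition, and fix λ₁ > 0. Then there exists C > 0 (depending only on g and λ₁) such that for every finite index set Λ of cardinality L ≥ 1, every family (λ_z)_{z∈Λ} with 0 < λ_z ≤ λ₁, and every real θ with 0 ≤ θ ≤ L, the product probability measure ⊗_{z∈Λ} n_{λ_z} on ℕ^Λ satisfies E[ exp( θ L^{−1} Σ_{z∈Λ} η_z ) ] ≤ e^{Cθ}. -/

import Mathlib

open Finset Real

/-- `gFact g k = g(k)! := g(1)g(2)⋯g(k)`, with `g(0)! = 1`. -/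
noncomputable def gFact (g : ℕ → ℝ) : ℕ → ℝ
  | 0 => 1
  | k + 1 => gFact g k * g (k + 1)

/-- The partition function `Z(λ) = Σ_k λ^k / g(k)!`. -/
noncomputable def Zfun (g : ℕ → ℝ) (l : ℝ) : ℝ := ∑' k : ℕ, l ^ k / gFact g k

/-- The mean density `R(λ) = Σ_k k λ^k / (g(k)! Z(λ))`. -/
noncomputable def Rfun (g : ℕ → ℝ) (l : ℝ) : ℝ :=
  ∑' k : ℕ, (k : ℝ) * l ^ k / (gFact g k * Zfun g l)

/-- The one-site equilibrium weight `n_λ(k) = λ^k / (g(k)! Z(λ))`. -/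
noncomputable def nWeight (g : ℕ → ℝ) (l : ℝ) (k : ℕ) : ℝ := l ^ k / (gFact g k * Zfun g l)

/-- The gap condition on the jump rate `g`: there are `n₀` and `c_g > 0` with
`g(n') − g(n) ≥ c_g` whenever `n' ≥ n + n₀`. -/
def GapCondition (g : ℕ → ℝ) : Prop :=
  ∃ n₀ : ℕ, ∃ cg : ℝ, 0 < cg ∧ ∀ n n' : ℕ, n + n₀ ≤ n' → cg ≤ g n' - g n

open MeasureTheory

/-- The one-site zero-range equilibrium measure `n_λ` on ℕ. -/
noncomputable def nMeasure (g : ℕ → ℝ) (l : ℝ) : Measure ℕ :=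
  Measure.sum fun k => ENNReal.ofReal (nWeight g l k) • Measure.dirac k

lemma gFact_pos {g : ℕ → ℝ} (hgpos : ∀ k : ℕ, 0 < k → 0 < g k) (k : ℕ) : 0 < gFact g k := by
  induction k with
  | zero => exact one_pos
  | succ k ih => exact mul_pos ih (hgpos _ k.succ_pos)

lemma GapCondition.tendsto_atTop {g : ℕ → ℝ} (hg : ∀ k, 0 ≤ g k) (hgap : GapCondition g) :
    Filter.Tendsto g Filter.atTop Filter.atTop := by
  obtain ⟨n₀, cg, hcg, h⟩ := hgap
  have key : ∀ m n : ℕ, m * n₀ ≤ n → m * cg ≤ g n := by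
    intro m
    induction m with
    | zero => intro n _; simpa using hg n
    | succ m ih =>
      intro n hn
      rw [Nat.succ_mul] at hn
      have h1 := ih (n - n₀) (by omega)
      have h2 := h (n - n₀) n (by omega)
      push_cast
      linarith
  refine Filter.tendsto_atTop.2 fun b => ?_
  obtain ⟨m, hm⟩ := exists_nat_ge (b / cg)
  filter_upwards [Filter.eventually_ge_atTop (m * n₀)] with n hn
  exact ((div_le_iff₀ hcg).1 hm).trans (key m n hn)

lemma summable_pow_div_gFact {g : ℕ → ℝ} (hgpos : ∀ k : ℕ, 0 < k → 0 < g k)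
    (hg : Filter.Tendsto g Filter.atTop Filter.atTop) {l : ℝ} (hl : 0 ≤ l) :
    Summable fun k : ℕ => l ^ k / gFact g k := by
  refine summable_of_ratio_norm_eventually_le (r := 1 / 2) (by norm_num) ?_
  have hev := (hg.comp (Filter.tendsto_add_atTop_nat 1)).eventually_ge_atTop (2 * l)
  filter_upwards [hev] with k hk
  have hk' : 2 * l ≤ g (k + 1) := hk
  have h1 := gFact_pos hgpos k
  have h2 := hgpos _ k.succ_pos
  have h3 : 0 ≤ l ^ k / gFact g k := by positivity
  have h4 : 0 ≤ l ^ (k + 1) / gFact g (k + 1) :=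
    div_nonneg (by positivity) (gFact_pos hgpos _).le
  rw [Real.norm_of_nonneg h3, Real.norm_of_nonneg h4]
  have h5 : l ^ (k + 1) / gFact g (k + 1) = (l / g (k + 1)) * (l ^ k / gFact g k) := by
    rw [gFact, pow_succ]
    field_simp
  rw [h5]
  refine mul_le_mul_of_nonneg_right ?_ h3
  rw [div_le_div_iff₀ h2 two_pos]
  linarith

lemma one_le_Zfun {g : ℕ → ℝ} (hgpos : ∀ k : ℕ, 0 < k → 0 < g k)
    (hg : Filter.Tendsto g Filter.atTop Filter.atTop) {l : ℝ} (hl : 0 ≤ l) :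
    1 ≤ Zfun g l := by
  have h := (summable_pow_div_gFact hgpos hg hl).le_tsum 0 fun k _ =>
    div_nonneg (pow_nonneg hl k) (gFact_pos hgpos k).le
  simpa [gFact, Zfun] using h

lemma Zfun_mono {g : ℕ → ℝ} (hgpos : ∀ k : ℕ, 0 < k → 0 < g k)
    (hg : Filter.Tendsto g Filter.atTop Filter.atTop) {l l' : ℝ} (hl : 0 ≤ l) (hll' : l ≤ l') :
    Zfun g l ≤ Zfun g l' :=
  (summable_pow_div_gFact hgpos hg hl).tsum_le_tsum
    (fun k => div_le_div_of_nonneg_right (pow_le_pow_left₀ hl hll' k) (gFact_pos hgpos k).le)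
    (summable_pow_div_gFact hgpos hg (hl.trans hll'))

lemma nWeight_eq_div (g : ℕ → ℝ) (l : ℝ) (k : ℕ) :
    nWeight g l k = l ^ k / gFact g k / Zfun g l := by
  rw [nWeight, div_div]

lemma hasSum_nWeight {g : ℕ → ℝ} (hgpos : ∀ k : ℕ, 0 < k → 0 < g k)
    (hg : Filter.Tendsto g Filter.atTop Filter.atTop) {l : ℝ} (hl : 0 ≤ l) :
    HasSum (nWeight g l) 1 := by
  have h := (summable_pow_div_gFact hgpos hg hl).hasSum.div_const (Zfun g l)
  rw [← Zfun, div_self (zero_lt_one.trans_le (one_le_Zfun hgpos hg hl)).ne'] at h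
  simpa only [← nWeight_eq_div] using h

lemma nWeight_nonneg {g : ℕ → ℝ} (hgpos : ∀ k : ℕ, 0 < k → 0 < g k)
    (hg : Filter.Tendsto g Filter.atTop Filter.atTop) {l : ℝ} (hl : 0 ≤ l) (k : ℕ) :
    0 ≤ nWeight g l k :=
  div_nonneg (pow_nonneg hl k)
    (mul_nonneg (gFact_pos hgpos k).le (zero_le_one.trans (one_le_Zfun hgpos hg hl)))

/-- The exponential moment of order one of `n_λ` is `Z(eλ) / Z(λ)`. -/
lemma hasSum_nWeight_mul_exp {g : ℕ → ℝ} (hgpos : ∀ k : ℕ, 0 < k → 0 < g k)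
    (hg : Filter.Tendsto g Filter.atTop Filter.atTop) {l : ℝ} (hl : 0 ≤ l) :
    HasSum (fun k : ℕ => nWeight g l k * Real.exp k) (Zfun g (Real.exp 1 * l) / Zfun g l) := by
  have h := (summable_pow_div_gFact hgpos hg
    (mul_nonneg (Real.exp_pos 1).le hl)).hasSum.div_const (Zfun g l)
  refine h.congr_fun ?_
  intro k
  rw [nWeight_eq_div, mul_pow, ← Real.exp_nat_mul, mul_one]
  ring

lemma lintegral_nMeasure (g : ℕ → ℝ) (l : ℝ) (f : ℕ → ENNReal) :
    ∫⁻ k, f k ∂(nMeasure g l) = ∑' k, ENNReal.ofReal (nWeight g l k) * f k := by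
  simp [nMeasure, lintegral_sum_measure]

lemma isProbabilityMeasure_nMeasure {g : ℕ → ℝ} (hgpos : ∀ k : ℕ, 0 < k → 0 < g k)
    (hg : Filter.Tendsto g Filter.atTop Filter.atTop) {l : ℝ} (hl : 0 ≤ l) :
    IsProbabilityMeasure (nMeasure g l) := by
  have h := hasSum_nWeight hgpos hg hl
  refine ⟨?_⟩
  rw [← lintegral_one, lintegral_nMeasure]
  simp only [mul_one]
  rw [← ENNReal.ofReal_tsum_of_nonneg (nWeight_nonneg hgpos hg hl) h.summable, h.tsum_eq,
    ENNReal.ofReal_one]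

/-- Convexity of the exponential on the segment from `0` to `x`. -/
lemma exp_mul_le_of_mem_Icc {s : ℝ} (hs0 : 0 ≤ s) (hs1 : s ≤ 1) (x : ℝ) :
    Real.exp (s * x) ≤ (1 - s) + s * Real.exp x := by
  simpa using convexOn_exp.2 (Set.mem_univ 0) (Set.mem_univ x) (sub_nonneg.2 hs1) hs0
    (sub_add_cancel 1 s)

lemma lintegral_exp_mul_nMeasure_le {g : ℕ → ℝ} (hgpos : ∀ k : ℕ, 0 < k → 0 < g k)
    (hg : Filter.Tendsto g Filter.atTop Filter.atTop) {l l₁ : ℝ} (hl : 0 ≤ l) (hl₁ : l ≤ l₁)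
    {s : ℝ} (hs0 : 0 ≤ s) (hs1 : s ≤ 1) :
    ∫⁻ k, ENNReal.ofReal (Real.exp (s * (k : ℝ))) ∂(nMeasure g l)
      ≤ ENNReal.ofReal (Real.exp (s * Zfun g (Real.exp 1 * l₁))) := by
  have hsum := ((hasSum_nWeight hgpos hg hl).mul_left (1 - s)).add
    ((hasSum_nWeight_mul_exp hgpos hg hl).mul_left s)
  have hw := nWeight_nonneg hgpos hg hl
  have hnonneg : ∀ k : ℕ,
      0 ≤ (1 - s) * nWeight g l k + s * (nWeight g l k * Real.exp k) := fun k =>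
    add_nonneg (mul_nonneg (sub_nonneg.2 hs1) (hw k))
      (mul_nonneg hs0 (mul_nonneg (hw k) (Real.exp_pos _).le))
  rw [lintegral_nMeasure]
  calc ∑' k : ℕ, ENNReal.ofReal (nWeight g l k) * ENNReal.ofReal (Real.exp (s * (k : ℝ)))
      ≤ ∑' k : ℕ, ENNReal.ofReal
          ((1 - s) * nWeight g l k + s * (nWeight g l k * Real.exp k)) := by
        refine ENNReal.tsum_le_tsum fun k => ?_
        rw [← ENNReal.ofReal_mul (hw k)]
        refine ENNReal.ofReal_le_ofReal ?_
        have := mul_le_mul_of_nonneg_left (exp_mul_le_of_mem_Icc hs0 hs1 (k : ℝ)) (hw k)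
        linarith
    _ = ENNReal.ofReal ((1 - s) * 1 + s * (Zfun g (Real.exp 1 * l) / Zfun g l)) := by
        rw [← ENNReal.ofReal_tsum_of_nonneg hnonneg hsum.summable, hsum.tsum_eq]
    _ ≤ ENNReal.ofReal (Real.exp (s * Zfun g (Real.exp 1 * l₁))) := by
        refine ENNReal.ofReal_le_ofReal ?_
        have he : 0 ≤ Real.exp 1 * l := mul_nonneg (Real.exp_pos 1).le hl
        have hZ : Zfun g (Real.exp 1 * l) / Zfun g l ≤ Zfun g (Real.exp 1 * l₁) :=
          (div_le_self (zero_le_one.trans (one_le_Zfun hgpos hg he))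
            (one_le_Zfun hgpos hg hl)).trans
            (Zfun_mono hgpos hg he (mul_le_mul_of_nonneg_left hl₁ (Real.exp_pos 1).le))
        have h1 := mul_le_mul_of_nonneg_left hZ hs0
        have h2 := Real.add_one_le_exp (s * Zfun g (Real.exp 1 * l₁))
        linarith

lemma lintegral_pi_prod_eval {ι : Type*} [Fintype ι] {α : ι → Type*}
    [∀ i, MeasurableSpace (α i)] (μ : ∀ i, Measure (α i)) [∀ i, IsProbabilityMeasure (μ i)]
    {f : ∀ i, α i → ENNReal} (hf : ∀ i, Measurable (f i)) :
    ∫⁻ x, ∏ i, f i (x i) ∂(Measure.pi μ) = ∏ i, ∫⁻ y, f i y ∂(μ i) := by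
  have h := ProbabilityTheory.lintegral_prod_eq_prod_lintegral_of_indepFun Finset.univ
    (fun i (x : ∀ i, α i) => f i (x i))
    (ProbabilityTheory.iIndepFun_pi (μ := μ) fun i => (hf i).aemeasurable)
    fun i => (hf i).comp (measurable_pi_apply i)
  refine h.trans ?_
  exact Finset.prod_congr rfl fun i _ => (measurePreserving_eval μ i).lintegral_comp (hf i)

/-- Uniform exponential moment bound for block averages: for `g` with the gap
condition and `λ₁ > 0` there is `C > 0` such that for every finite box `Λ` of cardinality
`L ≥ 1`, fugacities `0 < λ_z ≤ λ₁` and `0 ≤ θ ≤ L`, the product equilibrium measure satisfies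
`E[exp(θ L⁻¹ Σ_z η_z)] ≤ e^{Cθ}`. -/
theorem block_average_exponential_moment (g : ℕ → ℝ) (hg0 : g 0 = 0)
    (hgpos : ∀ k : ℕ, 0 < k → 0 < g k) (hgap : GapCondition g)
    (lam1 : ℝ) (hlam1 : 0 < lam1) :
    ∃ C > (0:ℝ), ∀ (Λ : Type) (_ : Fintype Λ) (L : ℕ), Fintype.card Λ = L → 1 ≤ L →
      ∀ lam : Λ → ℝ, (∀ z, 0 < lam z ∧ lam z ≤ lam1) →
      ∀ θ : ℝ, 0 ≤ θ → θ ≤ L →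
        ∫⁻ η, ENNReal.ofReal (Real.exp (θ * (L : ℝ)⁻¹ * ∑ z : Λ, (η z : ℝ)))
            ∂(Measure.pi fun z => nMeasure g (lam z))
          ≤ ENNReal.ofReal (Real.exp (C * θ)) := by
  have hg : Filter.Tendsto g Filter.atTop Filter.atTop :=
    hgap.tendsto_atTop fun k => k.eq_zero_or_pos.elim (fun h => by rw [h, hg0])
      fun h => (hgpos k h).le
  refine ⟨Zfun g (Real.exp 1 * lam1), zero_lt_one.trans_le
    (one_le_Zfun hgpos hg (mul_nonneg (Real.exp_pos 1).le hlam1.le)), ?_⟩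
  intro Λ _ L hcard hL lam hlam θ hθ0 hθL
  have hLpos : (0 : ℝ) < L := by exact_mod_cast hL
  have hs0 : 0 ≤ θ * (L : ℝ)⁻¹ := by positivity
  have hs1 : θ * (L : ℝ)⁻¹ ≤ 1 := by
    rw [← div_eq_mul_inv]
    exact (div_le_one hLpos).2 hθL
  have hprob : ∀ z, IsProbabilityMeasure (nMeasure g (lam z)) := fun z =>
    isProbabilityMeasure_nMeasure hgpos hg (hlam z).1.le
  simp_rw [Finset.mul_sum, Real.exp_sum,
    ENNReal.ofReal_prod_of_nonneg fun _ _ => (Real.exp_pos _).le]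
  rw [lintegral_pi_prod_eval (fun z => nMeasure g (lam z))
    (f := fun _ k => ENNReal.ofReal (Real.exp (θ * (L : ℝ)⁻¹ * (k : ℝ))))
    fun _ => measurable_from_top]
  calc ∏ z, ∫⁻ k, ENNReal.ofReal (Real.exp (θ * (L : ℝ)⁻¹ * (k : ℝ))) ∂(nMeasure g (lam z))
      ≤ ∏ _z : Λ, ENNReal.ofReal
          (Real.exp (θ * (L : ℝ)⁻¹ * Zfun g (Real.exp 1 * lam1))) :=
        Finset.prod_le_prod' fun z _ =>
          lintegral_exp_mul_nMeasure_le hgpos hg (hlam z).1.le (hlam z).2 hs0 hs1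
    _ = ENNReal.ofReal (Real.exp (Zfun g (Real.exp 1 * lam1) * θ)) := by
        rw [Finset.prod_const, Finset.card_univ, hcard,
          ← ENNReal.ofReal_pow (Real.exp_pos _).le, ← Real.exp_nat_mul]
        congr 2
        field_simp
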